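/- arXiv:2506.13218 — 2 statements merged into one kernel-verified Lean document; each statement's English description precedes it below -/
import Mathlib

section
/- Let d ≥ 1 and α > 0. For all M, B > 0 there exists a constant C = C(d, α, M, B) > 0 with the following property: for every probability measure μ on ℝᵈ with finite second moment satisfying M₂(μ) ≤ M and ‖b(μ)‖ < B, the unique minimizer ρ_μ of F_μ over probability measures with finite first moment satisfies M₂(ρ_μ) ≤ C. -/
open MeasureTheory ENNReal
open scoped RealInnerProductSpace

noncomputable section

/-- Euclidean space `ℝᵈ`. -/
abbrev Ed (d : ℕ) := EuclideanSpace ℝ (Fin d)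

/-- The positive part of an extended real number, as an element of `ℝ≥0∞`. -/
noncomputable def EReal.posPart (a : EReal) : ℝ≥0∞ :=
  if a = ⊤ then ⊤ else ENNReal.ofReal a.toReal

/-- Signed integral (with values in `EReal`) of a real-valued function. -/
noncomputable def sInt {α : Type*} [MeasurableSpace α] (ν : Measure α) (g : α → ℝ) : EReal :=
  ((∫⁻ x, ENNReal.ofReal (g x) ∂ν : ℝ≥0∞) : EReal) -
    ((∫⁻ x, ENNReal.ofReal (-(g x)) ∂ν : ℝ≥0∞) : EReal)

/-- Signed integral (with values in `EReal`) of an `EReal`-valued function. -/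
noncomputable def eInt {α : Type*} [MeasurableSpace α] (ν : Measure α) (f : α → EReal) : EReal :=
  ((∫⁻ x, (f x).posPart ∂ν : ℝ≥0∞) : EReal) - ((∫⁻ x, (-(f x)).posPart ∂ν : ℝ≥0∞) : EReal)

/-- The set of couplings (transport plans) between two measures on `ℝᵈ`. -/
def couplings {d : ℕ} (ρ μ : Measure (Ed d)) : Set (Measure (Ed d × Ed d)) :=
  {γ | IsProbabilityMeasure γ ∧ γ.map Prod.fst = ρ ∧ γ.map Prod.snd = μ}

/-- The maximal correlation functional `T(ρ, μ)`. -/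
noncomputable def maxCorr {d : ℕ} (ρ μ : Measure (Ed d)) : EReal :=
  ⨆ γ ∈ couplings ρ μ, sInt γ (fun p => ⟪p.1, p.2⟫)

/-- The entropy `E(ρ)` of a measure with respect to Lebesgue measure. -/
noncomputable def Ent {d : ℕ} (ρ : Measure (Ed d)) : EReal := by
  classical
  exact if _h : ρ ≪ (volume : Measure (Ed d)) then
    sInt (volume : Measure (Ed d))
      (fun x => (ρ.rnDeriv volume x).toReal * Real.log (ρ.rnDeriv volume x).toReal)
  else ⊤

/-- The second moment of a measure, with values in `ℝ≥0∞`. -/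
noncomputable def M2e {d : ℕ} (ρ : Measure (Ed d)) : ℝ≥0∞ :=
  ∫⁻ x, ENNReal.ofReal (‖x‖ ^ 2) ∂ρ

/-- The regularized functional `F_μ(ρ) = E(ρ) + T(ρ, μ) + (α/2) M₂(ρ)`. -/
noncomputable def Ffun {d : ℕ} (α : ℝ) (μ ρ : Measure (Ed d)) : EReal :=
  Ent ρ + maxCorr ρ μ + ((α / 2 : ℝ) : EReal) * ((M2e ρ : ℝ≥0∞) : EReal)

/-- The `p`-th moment `M_p(ρ) = ∫ ‖x‖^p dρ`. -/
noncomputable def Mp {d : ℕ} (p : ℝ) (ρ : Measure (Ed d)) : ℝ :=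
  ∫ x, ‖x‖ ^ p ∂ρ

/-- The barycenter `b(ρ) = ∫ x dρ`. -/
noncomputable def bary {d : ℕ} (ρ : Measure (Ed d)) : Ed d :=
  ∫ x, x ∂ρ

/-- Probability measures on `ℝᵈ` with finite first moment. -/
def P1 (d : ℕ) : Set (Measure (Ed d)) :=
  {ρ | IsProbabilityMeasure ρ ∧ Integrable (fun x => ‖x‖) ρ}

/-- Probability measures on `ℝᵈ` with finite second moment. -/
def P2 (d : ℕ) : Set (Measure (Ed d)) :=
  {ρ | IsProbabilityMeasure ρ ∧ Integrable (fun x => ‖x‖ ^ 2) ρ}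

/-- `ρ` is a minimizer of `F_μ` over probability measures with finite first moment. -/
def IsMinOfF {d : ℕ} (α : ℝ) (μ ρ : Measure (Ed d)) : Prop :=
  ρ ∈ P1 d ∧ ∀ σ ∈ P1 d, Ffun α μ ρ ≤ Ffun α μ σ

/-- The 2-Wasserstein distance between two measures on `ℝᵈ`. -/
noncomputable def W2 {d : ℕ} (ρ μ : Measure (Ed d)) : ℝ :=
  Real.sqrt ((⨅ γ ∈ couplings ρ μ, ∫⁻ p, ENNReal.ofReal (‖p.1 - p.2‖ ^ 2) ∂γ).toReal)

/-- Convexity of an `EReal`-valued function on `ℝᵈ`. -/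
def EConvexOn {d : ℕ} (u : Ed d → EReal) : Prop :=
  ∀ x y : Ed d, ∀ s t : ℝ, 0 ≤ s → 0 ≤ t → s + t = 1 →
    u (s • x + t • y) ≤ (s : EReal) * u x + (t : EReal) * u y

/-- The Legendre transform `u*(y) = sup_x (⟨x, y⟩ - u(x))` of an `EReal`-valued function. -/
noncomputable def legendre {d : ℕ} (u : Ed d → EReal) : Ed d → EReal :=
  fun y => ⨆ x : Ed d, (((⟪x, y⟫ : ℝ) : EReal) - u x)

/-- The Gaussian-regularized density `exp(-u(x) - (α/2)‖x‖²)`, with value `0` where `u = ⊤`. -/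
noncomputable def gdens {d : ℕ} (α : ℝ) (u : Ed d → EReal) (x : Ed d) : ℝ≥0∞ :=
  if u x = ⊤ then 0 else ENNReal.ofReal (Real.exp (-(u x).toReal - (α / 2) * ‖x‖ ^ 2))

theorem neg_le_sInt {β : Type*} [MeasurableSpace β] {ν : Measure β} {g : β → ℝ} {r : ℝ}
    (hr : 0 ≤ r) (h : ∫⁻ x, ENNReal.ofReal (-(g x)) ∂ν ≤ ENNReal.ofReal r) :
    ((-r : ℝ) : EReal) ≤ sInt ν g := by
  have h' : ((∫⁻ x, ENNReal.ofReal (-(g x)) ∂ν : ℝ≥0∞) : EReal) ≤ (r : EReal) := by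
    rw [← max_eq_left hr, ← EReal.coe_ennreal_ofReal]
    exact_mod_cast h
  calc ((-r : ℝ) : EReal) = 0 - (r : EReal) := by simp
    _ ≤ sInt ν g := EReal.sub_le_sub (EReal.coe_ennreal_nonneg _) h'

theorem sInt_le {β : Type*} [MeasurableSpace β] {ν : Measure β} {g : β → ℝ} {r : ℝ}
    (hr : 0 ≤ r) (h : ∫⁻ x, ENNReal.ofReal (g x) ∂ν ≤ ENNReal.ofReal r) :
    sInt ν g ≤ (r : EReal) := by
  have h' : ((∫⁻ x, ENNReal.ofReal (g x) ∂ν : ℝ≥0∞) : EReal) ≤ (r : EReal) := by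
    rw [← max_eq_left hr, ← EReal.coe_ennreal_ofReal]
    exact_mod_cast h
  calc sInt ν g ≤ (r : EReal) - 0 := EReal.sub_le_sub h' (EReal.coe_ennreal_nonneg _)
    _ = r := by simp

theorem neg_mul_log_le {t a : ℝ} (ht : 0 ≤ t) :
    -(t * Real.log t) ≤ t * a + Real.exp (-a) := by
  rcases ht.eq_or_lt with rfl | ht
  · simpa using (Real.exp_pos (-a)).le
  have h := Real.log_le_sub_one_of_pos (div_pos (Real.exp_pos (-a)) ht)
  rw [Real.log_div (Real.exp_pos _).ne' ht.ne', Real.log_exp] at h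
  have h2 := mul_le_mul_of_nonneg_left h ht.le
  have h3 : t * (Real.exp (-a) / t - 1) = Real.exp (-a) - t := by field_simp
  rw [h3] at h2
  linarith

theorem neg_mul_log_le_norm {d : ℕ} {t : ℝ} (ht : 0 ≤ t) (x : Ed d) :
    -(t * Real.log t) ≤ t * ((d + 1 : ℝ) * ‖x‖) + (1 + ‖x‖) ^ (-(d + 1 : ℝ)) := by
  have hx : 0 < 1 + ‖x‖ := by positivity
  have h := neg_mul_log_le (a := (d + 1 : ℝ) * Real.log (1 + ‖x‖)) ht
  have h2 : Real.exp (-((d + 1 : ℝ) * Real.log (1 + ‖x‖))) = (1 + ‖x‖) ^ (-(d + 1 : ℝ)) := by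
    rw [Real.rpow_def_of_pos hx]
    ring_nf
  have h3 : Real.log (1 + ‖x‖) ≤ ‖x‖ := by linarith [Real.log_le_sub_one_of_pos hx]
  rw [h2] at h
  have : t * ((d + 1 : ℝ) * Real.log (1 + ‖x‖)) ≤ t * ((d + 1 : ℝ) * ‖x‖) := by gcongr
  linarith

/-- Probability measures with finite first moment have entropy bounded below by an affine
function of that moment. -/
theorem neg_le_Ent {d : ℕ} {ρ : Measure (Ed d)} (hρ : ρ ∈ P1 d) :
    ((-((d + 1) * ∫ x, ‖x‖ ∂ρ + ∫ x : Ed d, (1 + ‖x‖) ^ (-(d + 1 : ℝ))) : ℝ) : EReal)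
      ≤ Ent ρ := by
  obtain ⟨_, hint⟩ := hρ
  have hK : Integrable (fun x : Ed d => (1 + ‖x‖) ^ (-(d + 1 : ℝ))) :=
    integrable_one_add_norm (by simp)
  have hm0 : 0 ≤ ∫ x, ‖x‖ ∂ρ := integral_nonneg fun _ => norm_nonneg _
  have hK0 : 0 ≤ ∫ x : Ed d, (1 + ‖x‖) ^ (-(d + 1 : ℝ)) :=
    integral_nonneg fun _ => by positivity
  unfold Ent
  split_ifs with hac
  swap
  · exact le_top
  refine neg_le_sInt (by positivity) ?_
  calc ∫⁻ x : Ed d, ENNReal.ofReal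
        (-((ρ.rnDeriv volume x).toReal * Real.log (ρ.rnDeriv volume x).toReal))
      ≤ ∫⁻ x : Ed d, (ρ.rnDeriv volume x * ENNReal.ofReal ((d + 1 : ℝ) * ‖x‖)
          + ENNReal.ofReal ((1 + ‖x‖) ^ (-(d + 1 : ℝ)))) := by
        refine lintegral_mono fun x => ?_
        refine (ENNReal.ofReal_le_ofReal
          (neg_mul_log_le_norm ENNReal.toReal_nonneg x)).trans ?_
        refine ENNReal.ofReal_add_le.trans ?_
        gcongr
        rw [ENNReal.ofReal_mul ENNReal.toReal_nonneg]
        gcongr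
        exact ENNReal.ofReal_toReal_le
    _ = ∫⁻ x, ENNReal.ofReal ((d + 1 : ℝ) * ‖x‖) ∂ρ
          + ∫⁻ x : Ed d, ENNReal.ofReal ((1 + ‖x‖) ^ (-(d + 1 : ℝ))) := by
        rw [lintegral_add_left (by fun_prop), lintegral_rnDeriv_mul hac (by fun_prop)]
    _ = _ := by
        rw [← ofReal_integral_eq_lintegral_ofReal (hint.const_mul _)
            (Filter.Eventually.of_forall fun _ => by positivity),
          ← ofReal_integral_eq_lintegral_ofReal hK
            (Filter.Eventually.of_forall fun _ => by positivity),
          integral_const_mul, ENNReal.ofReal_add (by positivity) hK0]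

theorem neg_le_maxCorr {d : ℕ} {ρ μ : Measure (Ed d)} (hρ : ρ ∈ P1 d) (hμ : μ ∈ P1 d) :
    ((-((∫ x, ‖x‖ ∂ρ) * ∫ y, ‖y‖ ∂μ) : ℝ) : EReal) ≤ maxCorr ρ μ := by
  obtain ⟨_, hρi⟩ := hρ
  obtain ⟨_, hμi⟩ := hμ
  have hmem : ρ.prod μ ∈ couplings ρ μ := ⟨inferInstance, by simp, by simp⟩
  refine le_trans ?_ (le_iSup₂ (f := fun γ (_ : γ ∈ couplings ρ μ) =>
    sInt γ (fun p => ⟪p.1, p.2⟫)) (ρ.prod μ) hmem)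
  have h0 : 0 ≤ (∫ x, ‖x‖ ∂ρ) * ∫ y, ‖y‖ ∂μ :=
    mul_nonneg (integral_nonneg fun _ => norm_nonneg _) (integral_nonneg fun _ => norm_nonneg _)
  refine neg_le_sInt h0 ?_
  rw [← integral_prod_mul, ofReal_integral_eq_lintegral_ofReal (hρi.mul_prod hμi)
    (Filter.Eventually.of_forall fun _ => by positivity)]
  refine lintegral_mono fun p => ENNReal.ofReal_le_ofReal ?_
  exact (neg_le_abs _).trans (abs_real_inner_le_norm _ _)

theorem maxCorr_le {d : ℕ} {ρ μ : Measure (Ed d)} {a b : ℝ} (ha : 0 ≤ a) (hb : 0 ≤ b)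
    (hρ : M2e ρ ≤ ENNReal.ofReal a) (hμ : M2e μ ≤ ENNReal.ofReal b) :
    maxCorr ρ μ ≤ ((a + b : ℝ) : EReal) := by
  refine iSup₂_le fun γ hγ => ?_
  obtain ⟨_, h1, h2⟩ := hγ
  refine sInt_le (by positivity) ?_
  calc ∫⁻ p : Ed d × Ed d, ENNReal.ofReal ⟪p.1, p.2⟫ ∂γ
      ≤ ∫⁻ p : Ed d × Ed d, (ENNReal.ofReal (‖p.1‖ ^ 2) + ENNReal.ofReal (‖p.2‖ ^ 2)) ∂γ := by
        refine lintegral_mono fun p => ?_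
        rw [← ENNReal.ofReal_add (by positivity) (by positivity)]
        refine ENNReal.ofReal_le_ofReal ?_
        have := real_inner_le_norm p.1 p.2
        nlinarith [sq_nonneg (‖p.1‖ - ‖p.2‖), sq_nonneg ‖p.1‖, sq_nonneg ‖p.2‖]
    _ = M2e ρ + M2e μ := by
        rw [lintegral_add_left (by fun_prop), M2e, M2e, ← h1, ← h2,
          lintegral_map (by fun_prop) (by fun_prop), lintegral_map (by fun_prop) (by fun_prop)]
    _ ≤ ENNReal.ofReal (a + b) := by
        rw [ENNReal.ofReal_add ha hb]
        gcongr

/-- The uniform measure on the unit ball of `ℝᵈ`. -/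
def unifBall (d : ℕ) : Measure (Ed d) :=
  (volume (Metric.ball (0 : Ed d) 1))⁻¹ • volume.restrict (Metric.ball (0 : Ed d) 1)

theorem volume_unitBall_ne_zero (d : ℕ) : volume (Metric.ball (0 : Ed d) 1) ≠ 0 :=
  (Metric.measure_ball_pos volume _ one_pos).ne'

instance (d : ℕ) : IsProbabilityMeasure (unifBall d) := by
  constructor
  simp only [unifBall, Measure.smul_apply, Measure.restrict_apply_univ, smul_eq_mul]
  exact ENNReal.inv_mul_cancel (volume_unitBall_ne_zero d) measure_ball_lt_top.ne

theorem unifBall_ae_norm_lt (d : ℕ) : ∀ᵐ x ∂(unifBall d), ‖x‖ < 1 := by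
  have h : ∀ᵐ x ∂(volume.restrict (Metric.ball (0 : Ed d) 1)), ‖x‖ < 1 := by
    filter_upwards [ae_restrict_mem Metric.isOpen_ball.measurableSet] with x hx
    simpa using hx
  exact Measure.ae_smul_measure h _

theorem unifBall_mem_P1 (d : ℕ) : unifBall d ∈ P1 d := by
  refine ⟨inferInstance, Integrable.of_bound (by fun_prop) 1 ?_⟩
  filter_upwards [unifBall_ae_norm_lt d] with x hx
  simpa using hx.le

theorem M2e_unifBall_le (d : ℕ) : M2e (unifBall d) ≤ ENNReal.ofReal 1 := by
  calc M2e (unifBall d) ≤ ∫⁻ _, 1 ∂(unifBall d) := by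
        refine lintegral_mono_ae ?_
        filter_upwards [unifBall_ae_norm_lt d] with x hx
        rw [← ENNReal.ofReal_one]
        refine ENNReal.ofReal_le_ofReal ?_
        nlinarith [norm_nonneg x]
    _ = ENNReal.ofReal 1 := by simp

theorem exists_Ent_unifBall_le (d : ℕ) : ∃ r : ℝ, 0 ≤ r ∧ Ent (unifBall d) ≤ (r : EReal) := by
  set s : Set (Ed d) := Metric.ball 0 1
  set c : ℝ≥0∞ := (volume s)⁻¹
  have hs : MeasurableSet s := Metric.isOpen_ball.measurableSet
  have hdens : unifBall d = volume.withDensity (s.indicator fun _ => c) := by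
    rw [withDensity_indicator hs, withDensity_const]
    rfl
  have hac : unifBall d ≪ volume := hdens ▸ withDensity_absolutelyContinuous _ _
  have hrn : (unifBall d).rnDeriv volume =ᵐ[volume] s.indicator fun _ => c := by
    rw [hdens]
    exact Measure.rnDeriv_withDensity _ (measurable_const.indicator hs)
  refine ⟨(ENNReal.ofReal (c.toReal * Real.log c.toReal) * volume s).toReal,
    ENNReal.toReal_nonneg, ?_⟩
  rw [Ent, dif_pos hac]
  refine sInt_le ENNReal.toReal_nonneg ?_
  rw [ENNReal.ofReal_toReal (ENNReal.mul_ne_top ENNReal.ofReal_ne_top measure_ball_lt_top.ne),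
    ← lintegral_indicator_const hs]
  refine lintegral_mono_ae ?_
  filter_upwards [hrn] with x hx
  by_cases hxs : x ∈ s <;> simp [hx, hxs]

theorem P2_subset_P1 {d : ℕ} {μ : Measure (Ed d)} (hμ : μ ∈ P2 d) : μ ∈ P1 d := by
  obtain ⟨_, hi⟩ := hμ
  refine ⟨inferInstance, Integrable.mono' ((integrable_const (1 : ℝ)).add hi) (by fun_prop)
    (Filter.Eventually.of_forall fun x => ?_)⟩
  simp only [norm_norm, Pi.add_apply]
  nlinarith [sq_nonneg (‖x‖ - 1), norm_nonneg x]

theorem integral_norm_le_of_P2 {d : ℕ} {μ : Measure (Ed d)} (hμ : μ ∈ P2 d) {ε : ℝ}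
    (hε : 0 < ε) : ∫ x, ‖x‖ ∂μ ≤ ε⁻¹ + ε * ∫ x, ‖x‖ ^ 2 ∂μ := by
  have hμ1 := P2_subset_P1 hμ
  obtain ⟨_, hi⟩ := hμ
  calc ∫ x, ‖x‖ ∂μ ≤ ∫ x, (ε⁻¹ + ε * ‖x‖ ^ 2) ∂μ := by
        refine integral_mono hμ1.2 ((integrable_const _).add (hi.const_mul _)) fun x => ?_
        have h : ε⁻¹ + ε * ‖x‖ ^ 2 - ‖x‖ = ε⁻¹ * ((ε * ‖x‖ - 1 / 2) ^ 2 + 3 / 4) := by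
          field_simp
          ring
        have : 0 ≤ ε⁻¹ * ((ε * ‖x‖ - 1 / 2) ^ 2 + 3 / 4) := by positivity
        simp only
        linarith
    _ = ε⁻¹ + ε * ∫ x, ‖x‖ ^ 2 ∂μ := by
        rw [integral_add (integrable_const _) (hi.const_mul _), integral_const_mul]
        simp

theorem M2e_eq_ofReal {d : ℕ} {μ : Measure (Ed d)} (hμ : μ ∈ P2 d) :
    M2e μ = ENNReal.ofReal (∫ x, ‖x‖ ^ 2 ∂μ) :=
  (ofReal_integral_eq_lintegral_ofReal hμ.2
    (Filter.Eventually.of_forall fun _ => by positivity)).symm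

theorem mem_P2_of_M2e_ne_top {d : ℕ} {ρ : Measure (Ed d)} [IsProbabilityMeasure ρ]
    (h : M2e ρ ≠ ⊤) : ρ ∈ P2 d :=
  ⟨inferInstance, (lintegral_ofReal_ne_top_iff_integrable (by fun_prop)
    (Filter.Eventually.of_forall fun _ => by positivity)).1 h⟩

/-- uniform bound on the second moment of the minimizer of `F_μ`. -/
theorem stmt11 (d : ℕ) (hd : 1 ≤ d) (α : ℝ) (hα : 0 < α) (M B : ℝ) (hM : 0 < M) (hB : 0 < B) :
    ∃ C : ℝ, 0 < C ∧
      ∀ μ : Measure (Ed d), μ ∈ P2 d → Mp 2 μ ≤ M → ‖bary μ‖ < B →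
        ∀ ρ : Measure (Ed d), IsMinOfF α μ ρ → M2e ρ ≤ ENNReal.ofReal C := by
  obtain ⟨e, he0, he⟩ := exists_Ent_unifBall_le d
  set K : ℝ := ∫ x : Ed d, (1 + ‖x‖) ^ (-(d + 1 : ℝ)) with hKdef
  have hK0 : 0 ≤ K := integral_nonneg fun _ => by positivity
  set L : ℝ := d + 1 + (1 + M) with hLdef
  have hL : 0 < L := by positivity
  set U : ℝ := e + (1 + M) + α / 2 with hUdef
  have hU : 0 < U := by positivity
  refine ⟨4 / α * (U + K + 4 * L ^ 2 / α), by positivity, ?_⟩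
  intro μ hμ hμM _ ρ ⟨hρ, hmin⟩
  have hμM' : ∫ x, ‖x‖ ^ 2 ∂μ ≤ M := by simpa [Mp] using hμM
  have := hρ.1
  have hupper : Ffun α μ ρ ≤ (U : EReal) := by
    refine (hmin _ (unifBall_mem_P1 d)).trans ?_
    have hT := maxCorr_le zero_le_one hM.le (M2e_unifBall_le d)
      ((M2e_eq_ofReal hμ).le.trans (ENNReal.ofReal_le_ofReal hμM'))
    have hQ : ((α / 2 : ℝ) : EReal) * ((M2e (unifBall d) : ℝ≥0∞) : EReal)
        ≤ ((α / 2 : ℝ) : EReal) := by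
      have h1 : ((M2e (unifBall d) : ℝ≥0∞) : EReal) ≤ 1 := by
        have := M2e_unifBall_le d
        rw [ENNReal.ofReal_one] at this
        exact_mod_cast this
      calc _ ≤ ((α / 2 : ℝ) : EReal) * 1 :=
            mul_le_mul_of_nonneg_left h1 (EReal.coe_nonneg.2 (by positivity))
        _ = _ := mul_one _
    calc Ffun α μ (unifBall d) ≤ (e : EReal) + ((1 + M : ℝ) : EReal) + ((α / 2 : ℝ) : EReal) :=
          add_le_add (add_le_add he hT) hQ
      _ = (U : EReal) := by rw [hUdef]; push_cast; rfl
  set m : ℝ := ∫ x, ‖x‖ ∂ρ with hmdef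
  have hm0 : 0 ≤ m := integral_nonneg fun _ => norm_nonneg _
  have hm' : ∫ x, ‖x‖ ∂μ ≤ 1 + M := by
    have := integral_norm_le_of_P2 hμ one_pos
    rw [inv_one, one_mul] at this
    linarith
  have hT := neg_le_maxCorr hρ (P2_subset_P1 hμ)
  have hlower : ((-(L * m + K) : ℝ) : EReal)
      + ((α / 2 : ℝ) : EReal) * ((M2e ρ : ℝ≥0∞) : EReal) ≤ Ffun α μ ρ := by
    refine add_le_add_left ?_ _
    refine le_trans ?_ (add_le_add (neg_le_Ent hρ) hT)
    rw [← EReal.coe_add, EReal.coe_le_coe_iff, hLdef]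
    have := mul_le_mul_of_nonneg_left hm' hm0
    linarith
  have hle := hlower.trans hupper
  have hfin : M2e ρ ≠ ⊤ := by
    intro htop
    rw [htop, EReal.coe_ennreal_top, EReal.coe_mul_top_of_pos (by positivity),
      EReal.coe_add_top] at hle
    exact EReal.coe_ne_top _ (top_le_iff.1 hle)
  have hρ2 := mem_P2_of_M2e_ne_top hfin
  rw [M2e_eq_ofReal hρ2] at hle ⊢
  set S : ℝ := ∫ x, ‖x‖ ^ 2 ∂ρ with hSdef
  have hS0 : 0 ≤ S := integral_nonneg fun _ => by positivity
  rw [EReal.coe_ennreal_ofReal, max_eq_left hS0, ← EReal.coe_mul, ← EReal.coe_add,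
    EReal.coe_le_coe_iff] at hle
  refine ENNReal.ofReal_le_ofReal ?_
  have hm := mul_le_mul_of_nonneg_left
    (integral_norm_le_of_P2 hρ2 (ε := α / (4 * L)) (by positivity)) hL.le
  have hexp : L * ((α / (4 * L))⁻¹ + α / (4 * L) * S) = 4 * L ^ 2 / α + α / 4 * S := by
    field_simp
  rw [← hmdef, ← hSdef, hexp] at hm
  have hfinal : α / 4 * S ≤ U + K + 4 * L ^ 2 / α := by linarith
  calc S = 4 / α * (α / 4 * S) := by field_simp
    _ ≤ _ := by gcongr
end
end

section
/- Let d ≥ 1, α > 0, let μ be a probability measure on ℝᵈ with finite first moment, and set μ̃ := (τ_{−b(μ)})_♯μ, so that b(μ̃) = 0. If ρ̃ is a minimizer of F_{μ̃} over probability measures with finite first moment, then ρ := (τ_{−b(μ)/α})_♯ρ̃ is a minimizer of F_μ over probability measures with finite first moment. -/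
open MeasureTheory ENNReal
open scoped RealInnerProductSpace

noncomputable section

/-- An integrable perturbation shifts a signed integral by its integral. -/
lemma sInt_add {α : Type*} [MeasurableSpace α] {ν : Measure α} {g h : α → ℝ}
    (hg : Measurable g) (hh : Measurable h) (hi : Integrable h ν) :
    sInt ν (fun x => g x + h x) = sInt ν g + ((∫ x, h x ∂ν : ℝ) : EReal) := by
  have hc : ∫⁻ x, ENNReal.ofReal (h x) ∂ν ≠ ⊤ := hi.lintegral_lt_top.ne
  have he : ∫⁻ x, ENNReal.ofReal (-(h x)) ∂ν ≠ ⊤ := hi.neg.lintegral_lt_top.ne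
  have key : (∫⁻ x, ENNReal.ofReal (g x + h x) ∂ν) + (∫⁻ x, ENNReal.ofReal (-(g x)) ∂ν)
      + (∫⁻ x, ENNReal.ofReal (-(h x)) ∂ν)
      = (∫⁻ x, ENNReal.ofReal (-(g x + h x)) ∂ν) + (∫⁻ x, ENNReal.ofReal (g x) ∂ν)
      + (∫⁻ x, ENNReal.ofReal (h x) ∂ν) := by
    rw [← lintegral_add_right _ (by fun_prop), ← lintegral_add_right _ (by fun_prop),
      ← lintegral_add_right _ (by fun_prop), ← lintegral_add_right _ (by fun_prop)]
    refine lintegral_congr fun x => ?_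
    have pos_part (a : ℝ) : ENNReal.ofReal a = ENNReal.ofReal (max a 0) := by
      rcases le_total a 0 with ha | ha <;> simp [ha]
    have key_real : max (g x + h x) 0 + max (-(g x)) 0 + max (-(h x)) 0
        = max (-(g x + h x)) 0 + max (g x) 0 + max (h x) 0 := by
      have h1 := max_zero_sub_max_neg_zero_eq_self (g x + h x)
      have h2 := max_zero_sub_max_neg_zero_eq_self (g x)
      have h3 := max_zero_sub_max_neg_zero_eq_self (h x)
      linarith
    rw [pos_part (g x + h x), pos_part (-(g x)), pos_part (-(h x)), pos_part (-(g x + h x)),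
      pos_part (g x), pos_part (h x)]
    simp only [← ENNReal.ofReal_add, le_max_right, add_nonneg, key_real]
  have bound_pos : (∫⁻ x, ENNReal.ofReal (g x + h x) ∂ν)
      ≤ (∫⁻ x, ENNReal.ofReal (g x) ∂ν) + ∫⁻ x, ENNReal.ofReal (h x) ∂ν := by
    rw [← lintegral_add_right _ (by fun_prop)]
    exact lintegral_mono fun x => ENNReal.ofReal_add_le
  have bound_neg : (∫⁻ x, ENNReal.ofReal (-(g x + h x)) ∂ν)
      ≤ (∫⁻ x, ENNReal.ofReal (-(g x)) ∂ν) + ∫⁻ x, ENNReal.ofReal (-(h x)) ∂ν := by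
    rw [← lintegral_add_right _ (by fun_prop)]
    refine lintegral_mono fun x => ?_
    rw [neg_add]
    exact ENNReal.ofReal_add_le
  have bound_pos' : (∫⁻ x, ENNReal.ofReal (g x) ∂ν)
      ≤ (∫⁻ x, ENNReal.ofReal (g x + h x) ∂ν) + ∫⁻ x, ENNReal.ofReal (-(h x)) ∂ν := by
    rw [← lintegral_add_right _ (by fun_prop)]
    refine lintegral_mono fun x => ?_
    simpa using ENNReal.ofReal_add_le (p := g x + h x) (q := -(h x))
  have bound_neg' : (∫⁻ x, ENNReal.ofReal (-(g x)) ∂ν)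
      ≤ (∫⁻ x, ENNReal.ofReal (-(g x + h x)) ∂ν) + ∫⁻ x, ENNReal.ofReal (h x) ∂ν := by
    rw [← lintegral_add_right _ (by fun_prop)]
    refine lintegral_mono fun x => ?_
    simpa using ENNReal.ofReal_add_le (p := -(g x + h x)) (q := h x)
  rw [integral_eq_lintegral_pos_part_sub_lintegral_neg_part hi]
  unfold sInt
  generalize (∫⁻ x, ENNReal.ofReal (g x + h x) ∂ν) = A at *
  generalize (∫⁻ x, ENNReal.ofReal (-(g x + h x)) ∂ν) = B at *
  generalize (∫⁻ x, ENNReal.ofReal (g x) ∂ν) = a at *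
  generalize (∫⁻ x, ENNReal.ofReal (-(g x)) ∂ν) = b at *
  generalize (∫⁻ x, ENNReal.ofReal (h x) ∂ν) = c at *
  generalize (∫⁻ x, ENNReal.ofReal (-(h x)) ∂ν) = e at *
  lift c to NNReal using hc
  lift e to NNReal using he
  have top_pos : A = ⊤ ↔ a = ⊤ := by
    constructor <;> rintro rfl <;> simp_all [top_le_iff]
  have top_neg : B = ⊤ ↔ b = ⊤ := by
    constructor <;> rintro rfl <;> simp_all [top_le_iff]
  by_cases hb : b = ⊤
  · rw [top_neg.2 hb, hb]
    simp [sub_eq_add_neg]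
  by_cases ha : a = ⊤
  · rw [top_pos.2 ha, ha]
    lift B to NNReal using mt top_neg.1 hb
    lift b to NNReal using hb
    rfl
  lift A to NNReal using mt top_pos.1 ha
  lift B to NNReal using mt top_neg.1 hb
  lift a to NNReal using ha
  lift b to NNReal using hb
  have hreal : (A : ℝ) + b + e = B + a + c := by exact_mod_cast key
  have : (A : ℝ) - B = a - b + (c - e) := by linarith
  simp only [ENNReal.coe_toReal, EReal.coe_nnreal_eq_coe_real]
  exact_mod_cast congrArg Real.toEReal this

lemma sInt_map {α β : Type*} [MeasurableSpace α] [MeasurableSpace β] {ν : Measure α}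
    {f : α → β} (hf : Measurable f) {g : β → ℝ} (hg : Measurable g) :
    sInt (ν.map f) g = sInt ν (fun x => g (f x)) := by
  unfold sInt
  rw [lintegral_map (by fun_prop) hf, lintegral_map (by fun_prop) hf]

lemma integrable_id_of_mem_P1 {d : ℕ} {ρ : Measure (Ed d)} (hρ : ρ ∈ P1 d) :
    Integrable (fun x : Ed d => x) ρ :=
  (integrable_norm_iff aestronglyMeasurable_id).1 hρ.2

lemma map_add_mem_P1 {d : ℕ} {ρ : Measure (Ed d)} (hρ : ρ ∈ P1 d) (v : Ed d) :
    ρ.map (fun x => x + v) ∈ P1 d := by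
  have := hρ.1
  refine ⟨Measure.isProbabilityMeasure_map (by fun_prop), ?_⟩
  rw [integrable_map_measure (by fun_prop) (by fun_prop)]
  exact ((integrable_id_of_mem_P1 hρ).add (integrable_const v)).norm

lemma map_add_map_neg_add {d : ℕ} (ρ : Measure (Ed d)) {u v : Ed d} (h : u + v = 0) :
    (ρ.map (fun x => x + u)).map (fun x => x + v) = ρ := by
  rw [Measure.map_map (by fun_prop) (by fun_prop)]
  simp [Function.comp_def, add_assoc, h]

/-- The entropy is translation invariant. -/
lemma Ent_map_add {d : ℕ} (ρ : Measure (Ed d)) [IsFiniteMeasure ρ] (v : Ed d) :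
    Ent (ρ.map (fun x => x + v)) = Ent ρ := by
  have hvol (w : Ed d) : (volume : Measure (Ed d)).map (fun x => x + w) = volume :=
    map_add_right_eq_self volume w
  have hac : ρ.map (fun x => x + v) ≪ volume ↔ ρ ≪ volume := by
    constructor
    · intro h
      have := h.map (f := fun x => x + (-v)) (by fun_prop)
      rwa [map_add_map_neg_add ρ (by simp), hvol] at this
    · intro h
      have := h.map (f := fun x => x + v) (by fun_prop)
      rwa [hvol] at this
  have hrn := (measurableEmbedding_addRight v).rnDeriv_map ρ volume
  simp only [hvol] at hrn
  unfold Ent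
  by_cases h : ρ ≪ volume
  · rw [dif_pos (hac.2 h), dif_pos h]
    conv_lhs => rw [← hvol v]
    rw [sInt_map (by fun_prop) (by fun_prop), hvol]
    unfold sInt
    congr 2 <;>
    · refine lintegral_congr_ae ?_
      filter_upwards [hrn] with x hx
      rw [hx]
  · rw [dif_neg (mt hac.1 h), dif_neg h]

lemma map_add_mem_couplings {d : ℕ} {ρ μ : Measure (Ed d)} {γ : Measure (Ed d × Ed d)}
    (hγ : γ ∈ couplings ρ μ) (u v : Ed d) :
    γ.map (fun p => (p.1 + u, p.2 + v)) ∈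
      couplings (ρ.map (fun x => x + u)) (μ.map (fun x => x + v)) := by
  obtain ⟨h, rfl, rfl⟩ := hγ
  refine ⟨Measure.isProbabilityMeasure_map (by fun_prop), ?_, ?_⟩ <;>
  · rw [Measure.map_map (by fun_prop) (by fun_prop), Measure.map_map (by fun_prop) (by fun_prop)]
    rfl

lemma sInt_inner_map_add {d : ℕ} {ρ μ : Measure (Ed d)} (hρ : ρ ∈ P1 d) (hμ : μ ∈ P1 d)
    {γ : Measure (Ed d × Ed d)} (hγ : γ ∈ couplings ρ μ) (u v : Ed d) :
    sInt (γ.map (fun p => (p.1 + u, p.2 + v))) (fun p => ⟪p.1, p.2⟫) =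
      sInt γ (fun p => ⟪p.1, p.2⟫) +
        ((⟪bary ρ, v⟫ + ⟪u, bary μ⟫ + ⟪u, v⟫ : ℝ) : EReal) := by
  have iρ := integrable_id_of_mem_P1 hρ
  have iμ := integrable_id_of_mem_P1 hμ
  obtain ⟨h, rfl, rfl⟩ := hγ
  have i1 : Integrable (fun p : Ed d × Ed d => p.1) γ := iρ.comp_measurable measurable_fst
  have i2 : Integrable (fun p : Ed d × Ed d => p.2) γ := iμ.comp_measurable measurable_snd
  have i1' : Integrable (fun p : Ed d × Ed d => (⟪p.1, v⟫ : ℝ)) γ := i1.inner_const v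
  have i2' : Integrable (fun p : Ed d × Ed d => (⟪u, p.2⟫ : ℝ)) γ := i2.const_inner u
  have i12 : Integrable (fun p : Ed d × Ed d => (⟪p.1, v⟫ + ⟪u, p.2⟫ : ℝ)) γ := i1'.add i2'
  have hb1 : bary (γ.map Prod.fst) = ∫ p, p.1 ∂γ :=
    integral_map (by fun_prop) (by fun_prop)
  have hb2 : bary (γ.map Prod.snd) = ∫ p, p.2 ∂γ :=
    integral_map (by fun_prop) (by fun_prop)
  have hint : ∫ p, (⟪p.1, v⟫ + ⟪u, p.2⟫ + ⟪u, v⟫ : ℝ) ∂γ =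
      ⟪bary (γ.map Prod.fst), v⟫ + ⟪u, bary (γ.map Prod.snd)⟫ + ⟪u, v⟫ := by
    rw [integral_add i12 (integrable_const _), integral_add i1' i2',
      integral_inner i2, hb1, hb2, real_inner_comm v (∫ p, p.1 ∂γ), ← integral_inner i1]
    simp [real_inner_comm]
  rw [sInt_map (by fun_prop) (by fun_prop), ← hint,
    ← sInt_add (h := fun p : Ed d × Ed d => (⟪p.1, v⟫ + ⟪u, p.2⟫ + ⟪u, v⟫ : ℝ))
      (by fun_prop) (by fun_prop) (i12.add (integrable_const _))]
  congr 1
  ext p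
  simp only [inner_add_left, inner_add_right]
  ring

lemma maxCorr_map_add {d : ℕ} {ρ μ : Measure (Ed d)} (hρ : ρ ∈ P1 d) (hμ : μ ∈ P1 d)
    (u v : Ed d) :
    maxCorr (ρ.map (fun x => x + u)) (μ.map (fun x => x + v)) =
      maxCorr ρ μ + ((⟪bary ρ, v⟫ + ⟪u, bary μ⟫ + ⟪u, v⟫ : ℝ) : EReal) := by
  apply le_antisymm
  · refine iSup₂_le fun γ hγ => ?_
    have hγ' := map_add_mem_couplings hγ (-u) (-v)
    rw [map_add_map_neg_add ρ (by simp), map_add_map_neg_add μ (by simp)] at hγ'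
    have h := sInt_inner_map_add hρ hμ hγ' u v
    rw [Measure.map_map (by fun_prop) (by fun_prop)] at h
    simp only [Function.comp_def, neg_add_cancel_right, Prod.mk.eta, Measure.map_id'] at h
    rw [h]
    gcongr
    exact le_iSup₂_of_le _ hγ' le_rfl
  · rw [← EReal.le_sub_iff_add_le (.inl (EReal.coe_ne_bot _)) (.inl (EReal.coe_ne_top _))]
    refine iSup₂_le fun γ hγ => ?_
    rw [EReal.le_sub_iff_add_le (.inl (EReal.coe_ne_bot _)) (.inl (EReal.coe_ne_top _)), ← sInt_inner_map_add hρ hμ hγ]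
    exact le_iSup₂_of_le _ (map_add_mem_couplings hγ u v) le_rfl

lemma coe_M2e {d : ℕ} (ρ : Measure (Ed d)) :
    ((M2e ρ : ℝ≥0∞) : EReal) = sInt ρ (fun x => ‖x‖ ^ 2) := by
  have : ∀ x : Ed d, ENNReal.ofReal (-(‖x‖ ^ 2)) = 0 := fun x =>
    ENNReal.ofReal_of_nonpos (by simp)
  simp [sInt, M2e, this]

lemma M2e_map_add {d : ℕ} {ρ : Measure (Ed d)} (hρ : ρ ∈ P1 d) (u : Ed d) :
    ((M2e (ρ.map (fun x => x + u)) : ℝ≥0∞) : EReal) =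
      ((M2e ρ : ℝ≥0∞) : EReal) + ((2 * ⟪bary ρ, u⟫ + ‖u‖ ^ 2 : ℝ) : EReal) := by
  have := hρ.1
  have i := integrable_id_of_mem_P1 hρ
  have i' : Integrable (fun x : Ed d => (2 * ⟪x, u⟫ : ℝ)) ρ := (i.inner_const u).const_mul 2
  have hint : ∫ x, (2 * ⟪x, u⟫ + ‖u‖ ^ 2 : ℝ) ∂ρ = 2 * ⟪bary ρ, u⟫ + ‖u‖ ^ 2 := by
    rw [integral_add i' (integrable_const _), integral_const_mul, real_inner_comm, bary,
      ← integral_inner i]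
    simp [real_inner_comm]
  rw [coe_M2e, coe_M2e, sInt_map (by fun_prop) (by fun_prop), ← hint,
    ← sInt_add (h := fun x : Ed d => (2 * ⟪x, u⟫ + ‖u‖ ^ 2 : ℝ))
      (by fun_prop) (by fun_prop) (i'.add (integrable_const _))]
  congr 1
  ext x
  rw [norm_add_sq_real]
  ring

/-- Simultaneous translation of both arguments changes the functional by a constant. -/
lemma Ffun_map_add {d : ℕ} {α : ℝ} (hα : 0 < α) {μ σ : Measure (Ed d)} (hμ : μ ∈ P1 d)
    (hσ : σ ∈ P1 d) :
    Ffun α μ (σ.map (fun x => x + (-(1 / α)) • bary μ)) =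
      Ffun α (μ.map (fun x => x + (-(bary μ)))) σ +
        ((-(‖bary μ‖ ^ 2 / (2 * α)) : ℝ) : EReal) := by
  have := hσ.1
  have h1 := maxCorr_map_add hσ hμ ((-(1 / α)) • bary μ) 0
  have h2 := maxCorr_map_add hσ hμ 0 (-(bary μ))
  simp only [add_zero, Measure.map_id', inner_zero_left, inner_zero_right, zero_add] at h1 h2
  unfold Ffun
  rw [Ent_map_add, h1, h2, M2e_map_add hσ,
    EReal.left_distrib_of_nonneg_of_ne_top (by exact_mod_cast (half_pos hα).le) (by simp),
    ← EReal.coe_mul]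
  have hc : (⟪(-(1 / α)) • bary μ, bary μ⟫ : ℝ) +
        α / 2 * (2 * ⟪bary σ, (-(1 / α)) • bary μ⟫ + ‖(-(1 / α)) • bary μ‖ ^ 2) =
      ⟪bary σ, -(bary μ)⟫ + -(‖bary μ‖ ^ 2 / (2 * α)) := by
    rw [real_inner_smul_left, real_inner_smul_right, real_inner_self_eq_norm_sq, inner_neg_right,
      norm_smul, mul_pow, Real.norm_eq_abs, sq_abs]
    field_simp
    ring
  have hc' := congrArg Real.toEReal hc
  rw [EReal.coe_add, EReal.coe_add] at hc'
  calc _ = Ent σ + maxCorr σ μ + ((α / 2 : ℝ) : EReal) * ((M2e σ : ℝ≥0∞) : EReal) +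
        (((⟪(-(1 / α)) • bary μ, bary μ⟫ : ℝ) : EReal) +
          ((α / 2 * (2 * ⟪bary σ, (-(1 / α)) • bary μ⟫ + ‖(-(1 / α)) • bary μ‖ ^ 2) : ℝ) :
            EReal)) := by abel
    _ = _ := by rw [hc']; abel

/-- a minimizer for the centered measure translates to a minimizer for `μ`. -/
theorem stmt14 (d : ℕ) (hd : 1 ≤ d) (α : ℝ) (hα : 0 < α)
    (μ : Measure (Ed d)) (hμ : μ ∈ P1 d)
    (ρt : Measure (Ed d))
    (hmin : IsMinOfF α (μ.map (fun x => x + (-(bary μ)))) ρt) :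
    IsMinOfF α μ (ρt.map (fun x => x + (-(1 / α)) • bary μ)) := by
  refine ⟨map_add_mem_P1 hmin.1 _, fun σ hσ => ?_⟩
  have hσ' := map_add_mem_P1 hσ ((1 / α) • bary μ)
  have h := Ffun_map_add hα hμ hσ'
  rw [map_add_map_neg_add σ (by simp)] at h
  rw [Ffun_map_add hα hμ hmin.1, h]
  gcongr
  exact hmin.2 _ hσ'
end
end
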